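/- arXiv:2003.01205 — 7 statements merged into one kernel-verified Lean document; each statement's English description precedes it below -/
import Mathlib

section
/- Let G be a finite group and let A be an abelian subgroup of G that is maximal among the soluble subgroups of G (i.e., every soluble subgroup of G containing A is equal to A). Then A = G; in particular, G is abelian. -/
open Subgroup Pointwise

theorem isSolvable_of_normal_sup_eq_top {G : Type*} [Group G] {N A : Subgroup G} [N.Normal]
    (hN : Group.IsSolvable N) (hA : Group.IsSolvable A) (h : N ⊔ A = ⊤) :
    Group.IsSolvable G := by
  rw [Group.isSolvable_iff_subgroup_quotient N]
  refine ⟨hN, Group.isSolvable_of_surjective (f := (QuotientGroup.mk' N).comp A.subtype) ?_⟩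
  rw [← MonoidHom.range_eq_top, MonoidHom.range_comp, range_subtype, ← comap_injective
    (QuotientGroup.mk'_surjective N) |>.eq_iff, comap_map_eq, QuotientGroup.ker_mk', sup_comm, h,
    comap_top]

/-- A subgroup is maximal soluble if it is maximal among the soluble subgroups. -/
def IsMaximalSolvable {G : Type*} [Group G] (A : Subgroup G) : Prop :=
  Group.IsSolvable A ∧ ∀ H : Subgroup G, Group.IsSolvable H → A ≤ H → A = H

namespace IsMaximalSolvable

variable {G : Type*} [Group G] {A : Subgroup G}

theorem eq_top (hA : IsMaximalSolvable A) (hG : Group.IsSolvable G) : A = ⊤ :=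
  hA.2 ⊤ inferInstance le_top

theorem subgroupOf (hA : IsMaximalSolvable A) {M : Subgroup G} (hAM : A ≤ M) :
    IsMaximalSolvable (A.subgroupOf M) := by
  have := hA.1
  refine ⟨Group.isSolvable_of_isSolvable_injective
    (f := (subgroupOfEquivOfLe hAM).toMonoidHom) (subgroupOfEquivOfLe hAM).injective,
    fun H hH hle => ?_⟩
  have h := hA.2 (H.map M.subtype)
    (Group.isSolvable_of_surjective (M.subtype.subgroupMap_surjective H))
    (by simpa [map_subgroupOf_eq_of_le hAM] using map_mono (f := M.subtype) hle)
  rw [h, Subgroup.subgroupOf, comap_map_eq_self_of_injective M.subtype_injective]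

theorem map_mk (hA : IsMaximalSolvable A) {N : Subgroup G} [N.Normal] (hNA : N ≤ A) :
    IsMaximalSolvable (A.map (QuotientGroup.mk' N)) := by
  have := hA.1
  refine ⟨Group.isSolvable_of_surjective ((QuotientGroup.mk' N).subgroupMap_surjective A),
    fun H hH hle => ?_⟩
  have hN : Group.IsSolvable N :=
    Group.isSolvable_of_isSolvable_injective (inclusion_injective hNA)
  have hNH : N ≤ H.comap (QuotientGroup.mk' N) := by
    simpa using ker_le_comap (QuotientGroup.mk' N) H
  have hcomap : Group.IsSolvable (H.comap (QuotientGroup.mk' N)) := by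
    refine Group.isSolvable_of_ker_le_range (inclusion hNH)
      ((QuotientGroup.mk' N).subgroupComap H) fun x hx => ?_
    have hxN : (x : G) ∈ N :=
      (QuotientGroup.eq_one_iff (x : G)).mp (congrArg Subtype.val (MonoidHom.mem_ker.mp hx))
    exact ⟨⟨x, hxN⟩, rfl⟩
  rw [hA.2 _ hcomap (map_le_iff_le_comap.mp hle),
    map_comap_eq_self_of_surjective (QuotientGroup.mk'_surjective N)]

end IsMaximalSolvable

section CoatomWithTrivialCore

variable {G : Type*} [Group G] [Finite G] {A : Subgroup G}

/-- The normalizer of a nontrivial Sylow subgroup of an abelian, core-free, maximal subgroup `A`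
is `A`, so it is a Sylow subgroup of the whole group. -/
theorem exists_sylow_le_normalizer_eq (hab : ∀ a ∈ A, ∀ b ∈ A, a * b = b * a) (hA : IsCoatom A)
    (hcore : ∀ N : Subgroup G, N.Normal → N ≤ A → N = ⊥) (p : ℕ) [Fact p.Prime]
    (hp : p ∣ Nat.card A) :
    ∃ P : Sylow p G, (P : Subgroup G) ≤ A ∧ normalizer (P : Set G) = A := by
  obtain ⟨P₀⟩ : Nonempty (Sylow p A) := inferInstance
  set P : Subgroup G := (P₀ : Subgroup A).map A.subtype with hPdef
  have hPA : P ≤ A := map_subtype_le _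
  have hPb : P ≠ ⊥ := fun h =>
    P₀.ne_bot_of_dvd_card hp ((map_eq_bot_iff_of_injective _ A.subtype_injective).mp h)
  have hAN : A ≤ normalizer (P : Set G) := fun a ha =>
    centralizer_le_normalizer _ (mem_centralizer_iff.mpr fun x hx => hab x (hPA hx) a ha)
  have hN : normalizer (P : Set G) = A := by
    refine (hA.le_iff.mp hAN).resolve_left fun h => hPb (hcore P ?_ hPA)
    exact normalizer_eq_top_iff.mp h
  have hpP : IsPGroup p P := P₀.isPGroup'.map _
  obtain ⟨n, hn⟩ := IsPGroup.iff_card.mp hpP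
  have hidx : ¬ p ∣ P.index := by
    have h := Sylow.card_quotient_normalizer_modEq_card_quotient (p := p) hn
    have h1 : Nat.card (normalizer (P : Set G) ⧸ P.comap (normalizer (P : Set G)).subtype)
        = (P₀ : Subgroup A).index := by
      change P.relIndex (normalizer (P : Set G)) = _
      rw [hN, relIndex, Subgroup.subgroupOf, hPdef,
        comap_map_eq_self_of_injective A.subtype_injective]
    rw [h1] at h
    exact fun hd => P₀.not_dvd_index ((h.dvd_iff dvd_rfl).mpr hd)
  exact ⟨hpP.toSylow hidx, hPA, hN⟩

/-- By Burnside's transfer theorem, the commutator subgroup has order prime to that of `A`. -/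
theorem coprime_card_commutator (hab : ∀ a ∈ A, ∀ b ∈ A, a * b = b * a) (hA : IsCoatom A)
    (hcore : ∀ N : Subgroup G, N.Normal → N ≤ A → N = ⊥) :
    (Nat.card (commutator G)).Coprime (Nat.card A) := by
  refine Nat.Coprime.symm (Nat.coprime_of_dvd fun p hp hpA hpG => ?_)
  have : Fact p.Prime := ⟨hp⟩
  obtain ⟨P, hPA, hN⟩ := exists_sylow_le_normalizer_eq hab hA hcore p hpA
  have hP : normalizer (P : Set G) ≤ centralizer (P : Set G) := fun a ha =>
    mem_centralizer_iff.mpr fun x hx => hab x (hPA hx) a (hN ▸ ha)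
  refine MonoidHom.not_dvd_card_ker_transferSylow P hP (hpG.trans (card_dvd_of_le ?_))
  refine commutator_le.mpr fun a _ b _ => ?_
  rw [MonoidHom.mem_ker, map_commutatorElement, commutatorElement_eq_one_iff_mul_comm]
  exact Subtype.ext (hab _ (hPA (Subtype.prop _)) _ (hPA (Subtype.prop _)))

/-- An abelian subgroup `B` of the same order as an abelian, core-free, maximal subgroup `A` contains
a conjugate of `A`. -/
theorem exists_conj_mem_of_card_eq (hab : ∀ a ∈ A, ∀ b ∈ A, a * b = b * a) (hA : IsCoatom A)
    (hcore : ∀ N : Subgroup G, N.Normal → N ≤ A → N = ⊥) {B : Subgroup G}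
    (hB : ∀ a ∈ B, ∀ b ∈ B, a * b = b * a) (hcard : Nat.card B = Nat.card A) :
    ∃ g : G, ∀ a ∈ A, g * a * g⁻¹ ∈ B := by
  by_cases hA1 : Nat.card A = 1
  · refine ⟨1, fun a ha => ?_⟩
    rw [card_eq_one.mp hA1, mem_bot] at ha
    simp [ha, B.one_mem]
  obtain ⟨p, hp, hpA⟩ := Nat.exists_prime_and_dvd hA1
  have : Fact p.Prime := ⟨hp⟩
  obtain ⟨P, hPA, hN⟩ := exists_sylow_le_normalizer_eq hab hA hcore p hpA
  have hidx : B.index = A.index := by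
    have h := B.card_mul_index.trans A.card_mul_index.symm
    rw [hcard] at h
    exact Nat.eq_of_mul_eq_mul_left Nat.card_pos h
  obtain ⟨R₀⟩ : Nonempty (Sylow p B) := inferInstance
  have hR : IsPGroup p ((R₀ : Subgroup B).map B.subtype) := R₀.isPGroup'.map _
  have hRi : ¬ p ∣ ((R₀ : Subgroup B).map B.subtype).index := by
    rw [index_map_subtype, hidx, hp.dvd_mul, not_or]
    exact ⟨R₀.not_dvd_index, fun h => P.not_dvd_index (h.trans (index_dvd_of_le hPA))⟩
  obtain ⟨g, hg⟩ := MulAction.exists_smul_eq G P (hR.toSylow hRi)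
  have hRB : ∀ x ∈ hR.toSylow hRi, x ∈ B := fun x hx => map_subtype_le (R₀ : Subgroup B) hx
  have hle : B.map (MulAut.conj g⁻¹).toMonoidHom ≤ A := by
    rintro _ ⟨b, hb, rfl⟩
    have hbR : b • hR.toSylow hRi = hR.toSylow hRi :=
      Sylow.smul_eq_iff_mem_normalizer.mpr (centralizer_le_normalizer _
        (mem_centralizer_iff.mpr fun x hx => hB x (hRB x hx) b hb))
    rw [← hN, ← Sylow.smul_eq_iff_mem_normalizer]
    have : (g⁻¹ * b * g) • P = P := by
      rw [mul_smul, mul_smul, hg, hbR, ← hg, inv_smul_smul]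
    simpa using this
  have heq : B.map (MulAut.conj g⁻¹).toMonoidHom = A := by
    refine eq_of_le_of_card_ge hle ?_
    rw [card_map_of_injective (MulAut.conj g⁻¹).injective, hcard]
  refine ⟨g, fun a ha => ?_⟩
  rw [← heq] at ha
  obtain ⟨b, hb, rfl⟩ := ha
  simpa [mul_assoc] using hb

/-- An abelian, core-free, maximal subgroup `A` complementing the commutator subgroup normalizes a
nontrivial subgroup of prime power order not contained in `A`. -/
theorem exists_isPGroup_le_normalizer (hab : ∀ a ∈ A, ∀ b ∈ A, a * b = b * a) (hA : IsCoatom A)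
    (hcore : ∀ N : Subgroup G, N.Normal → N ≤ A → N = ⊥) (hne : commutator G ≠ ⊥) :
    ∃ q : ℕ, q.Prime ∧ ∃ S : Subgroup G, IsPGroup q S ∧ ¬ S ≤ A ∧
      A ≤ normalizer (S : Set G) := by
  have hcop := coprime_card_commutator hab hA hcore
  have hsup : commutator G ⊔ A = ⊤ :=
    (hA.le_iff.mp le_sup_right).resolve_right fun h =>
      hne (hcore _ inferInstance (sup_eq_right.mp h))
  have hdisj : Disjoint (commutator G) A := disjoint_of_coprime_natCard hcop
  have hindex : (commutator G).index = Nat.card A := by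
    refine (isComplement'_of_disjoint_and_mul_eq_univ hdisj.symm ?_).index_eq_card
    rw [← mul_normal, sup_comm, hsup, coe_top]
  obtain ⟨q, hq, hqd⟩ := Nat.exists_prime_and_dvd (mt card_eq_one.mp hne)
  have : Fact q.Prime := ⟨hq⟩
  obtain ⟨Q⟩ : Nonempty (Sylow q (commutator G)) := inferInstance
  set S : Subgroup G := (Q : Subgroup (commutator G)).map (commutator G).subtype
  have hSle : S ≤ commutator G := map_subtype_le _
  have hSb : S ≠ ⊥ := fun h => Q.ne_bot_of_dvd_card hqd
    ((map_eq_bot_iff_of_injective _ (commutator G).subtype_injective).mp h)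
  have hqS : IsPGroup q S := Q.isPGroup'.map _
  set N : Subgroup G := normalizer (S : Set G)
  have hfrat : N ⊔ commutator G = ⊤ := Q.normalizer_sup_eq_top
  have hidx : ((commutator G).subgroupOf N).index = Nat.card A := by
    change (commutator G).relIndex N = _
    rw [← relIndex_sup_right, hfrat, relIndex_top_right, hindex]
  have hcard : Nat.card ((commutator G).subgroupOf N) ∣ Nat.card (commutator G) :=
    card_comap_dvd_of_injective _ _ N.subtype_injective
  obtain ⟨B₀, hB₀⟩ := exists_left_complement'_of_coprime
    (N := (commutator G).subgroupOf N) (hidx ▸ hcop.coprime_dvd_left hcard)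
  have hBcard : Nat.card (B₀.map N.subtype) = Nat.card A := by
    rw [card_map_of_injective N.subtype_injective, ← hidx, hB₀.index_eq_card]
  have hBdisj : Disjoint (commutator G) (B₀.map N.subtype) :=
    disjoint_of_coprime_natCard (hBcard ▸ hcop)
  obtain ⟨g, hg⟩ := exists_conj_mem_of_card_eq hab hA hcore (B := B₀.map N.subtype)
    (fun a ha b hb => commutatorElement_eq_one_iff_mul_comm.mp (disjoint_def.mp hBdisj
      (commutator_mem_commutator (mem_top a) (mem_top b))
      (mul_mem (mul_mem (mul_mem ha hb) (inv_mem ha)) (inv_mem hb)))) hBcard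
  refine ⟨q, hq, S.map (MulAut.conj g⁻¹).toMonoidHom, hqS.map _, fun hle => hSb ?_, fun a ha => ?_⟩
  · have hle' : S.map (MulAut.conj g⁻¹).toMonoidHom ≤ commutator G := by
      rintro _ ⟨s, hs, rfl⟩
      exact Normal.conj_mem inferInstance s (hSle hs) g⁻¹
    exact (map_eq_bot_iff_of_injective _ (MulAut.conj g⁻¹).injective).mp
      (le_bot_iff.mp (hdisj hle' hle))
  · have hN : g * a * g⁻¹ ∈ N := map_subtype_le B₀ (hg a ha)
    have hmem : ∀ x, x ∈ S.map (MulAut.conj g⁻¹).toMonoidHom ↔ g * x * g⁻¹ ∈ S := by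
      intro x
      constructor
      · rintro ⟨s, hs, rfl⟩
        simpa [mul_assoc] using hs
      · exact fun h => ⟨_, h, by simp [mul_assoc]⟩
    rw [mem_normalizer_iff]
    intro x
    rw [hmem, hmem, mem_normalizer_iff.mp hN]
    simp [mul_assoc]

end CoatomWithTrivialCore

theorem IsMaximalSolvable.eq_top_of_abelian {G : Type*} [Group G] [Finite G] {A : Subgroup G}
    (hA : IsMaximalSolvable A) (hab : ∀ a ∈ A, ∀ b ∈ A, a * b = b * a) : A = ⊤ := by
  induction hn : Nat.card G using Nat.strong_induction_on generalizing G with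
  | _ n ih =>
  subst hn
  by_contra hne
  have hcoatom : IsCoatom A := by
    refine ⟨hne, fun M hM => by_contra fun hMt => hM.not_ge ?_⟩
    refine subgroupOf_eq_top.mp (ih _ ?_ (hA.subgroupOf hM.le) ?_ rfl)
    · exact lt_of_le_of_ne (card_le_card_group M) (mt (card_eq_iff_eq_top M).mp hMt)
    · exact fun a ha b hb => Subtype.ext (hab a ha b hb)
  have hcore : ∀ N : Subgroup G, N.Normal → N ≤ A → N = ⊥ := by
    intro N _ hNA
    by_contra hNb
    refine hne ?_
    have h := ih (Nat.card (G ⧸ N)) ?_ (hA.map_mk hNA) ?_ rfl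
    · have := congrArg (comap (QuotientGroup.mk' N)) h
      rwa [comap_map_eq_self (by simpa using hNA), comap_top] at this
    · have h1 : 1 < Nat.card N := (one_lt_card_iff_ne_bot N).mpr hNb
      rw [N.card_eq_card_quotient_mul_card_subgroup]
      exact lt_mul_of_one_lt_right Nat.card_pos h1
    · rintro _ ⟨a, ha, rfl⟩ _ ⟨b, hb, rfl⟩
      rw [← map_mul, hab a ha b hb, map_mul]
  by_cases hc : commutator G = ⊥
  · exact hne (hA.eq_top ⟨⟨1, by rwa [derivedSeries_one]⟩⟩)
  obtain ⟨q, hq, S, hS, hSA, hAS⟩ := exists_isPGroup_le_normalizer hab hcoatom hcore hc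
  have : Fact q.Prime := ⟨hq⟩
  have hSN : normalizer (S : Set G) = ⊤ :=
    (hcoatom.le_iff.mp hAS).resolve_right fun h => hSA (le_normalizer.trans h.le)
  have : S.Normal := normalizer_eq_top_iff.mp hSN
  have : Group.IsNilpotent S := hS.isNilpotent
  have hsup : S ⊔ A = ⊤ :=
    (hcoatom.le_iff.mp le_sup_right).resolve_right fun h => hSA (sup_eq_right.mp h)
  exact hne (hA.eq_top (isSolvable_of_normal_sup_eq_top inferInstance hA.1 hsup))

theorem stmt_0 (G : Type*) [Group G] [Finite G] (A : Subgroup G)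
    (hab : ∀ a ∈ A, ∀ b ∈ A, a * b = b * a)
    (hsol : IsSolvable A)
    (hmax : ∀ H : Subgroup G, IsSolvable H → A ≤ H → A = H) :
    A = ⊤ ∧ ∀ a b : G, a * b = b * a := by
  have htop : A = ⊤ := IsMaximalSolvable.eq_top_of_abelian ⟨hsol, hmax⟩ hab
  subst htop
  exact ⟨rfl, fun a b => hab a (mem_top a) b (mem_top b)⟩
end

section
/- Let G be a finite group. If there exists an element x ∈ G such that all elements of Sol_G(x) commute pairwise (i.e., for all y, z ∈ Sol_G(x), yz = zy), then G is abelian. -/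
open Subgroup

section Solvable

variable {G : Type*} [Group G]

theorem isSolvable_of_le {H K : Subgroup G} (hHK : H ≤ K) (hK : Group.IsSolvable K) :
    Group.IsSolvable H :=
  Group.isSolvable_of_isSolvable_injective (inclusion_injective hHK)

theorem isSolvable_map {G' : Type*} [Group G'] (f : G →* G') (H : Subgroup G)
    (hH : Group.IsSolvable H) : Group.IsSolvable (H.map f) :=
  Group.isSolvable_of_surjective (f.subgroupMap_surjective H)

theorem isSolvable_of_isSolvable_map {G' : Type*} [Group G'] (f : G →* G') (H : Subgroup G)
    (hf : Group.IsSolvable f.ker) (hH : Group.IsSolvable (H.map f)) : Group.IsSolvable H := by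
  have : Group.IsSolvable (f.ker ⊓ H : Subgroup G) := isSolvable_of_le inf_le_left hf
  refine Group.isSolvable_of_ker_le_range (inclusion (inf_le_right : f.ker ⊓ H ≤ H))
    (f.subgroupMap H) fun a ha => ?_
  have hfa : f a = 1 := congrArg Subtype.val (MonoidHom.mem_ker.mp ha)
  exact ⟨⟨a, MonoidHom.mem_ker.mpr hfa, a.2⟩, rfl⟩

theorem isSolvable_sup_of_le_normalizer {H N : Subgroup G} (hHN : H ≤ normalizer N)
    (hH : Group.IsSolvable H) (hN : Group.IsSolvable N) :
    Group.IsSolvable (H ⊔ N : Subgroup G) := by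
  have := Subgroup.normal_subgroupOf_of_le_normalizer hHN
  have := Subgroup.normal_subgroupOf_sup_of_le_normalizer hHN
  rw [Group.isSolvable_iff_subgroup_quotient (N.subgroupOf (H ⊔ N))]
  exact ⟨Group.isSolvable_of_isSolvable_injective (f := MulEquiv.toMonoidHom _)
      (subgroupOfEquivOfLe (le_sup_right : N ≤ H ⊔ N)).injective,
    Group.isSolvable_of_surjective (f := MulEquiv.toMonoidHom _)
      (QuotientGroup.quotientInfEquivProdNormalizerQuotient H N hHN).surjective⟩

theorem isSolvable_closure_pair_of_commute {x y : G} (hxy : x * y = y * x) :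
    Group.IsSolvable (closure {x, y}) := by
  have : IsMulCommutative (closure {x, y}) := Subgroup.isMulCommutative_closure (by
    rintro a (rfl | rfl) b (rfl | rfl) <;> simp [hxy])
  exact Group.isSolvable_of_comm fun a b => mul_comm' a b

end Solvable

/-- The elements generating a soluble subgroup together with `x` commute pairwise. -/
def HasCommSolubilizer {G : Type*} [Group G] (x : G) : Prop :=
  ∀ y z : G, Group.IsSolvable (closure {x, y}) → Group.IsSolvable (closure {x, z}) → y * z = z * y

namespace HasCommSolubilizer

variable {G : Type*} [Group G] {x : G}

theorem commute_of_mem (hx : HasCommSolubilizer x) {H : Subgroup G} (hH : Group.IsSolvable H)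
    (hxH : x ∈ H) {a b : G} (ha : a ∈ H) (hb : b ∈ H) : a * b = b * a := by
  have key : ∀ c ∈ H, Group.IsSolvable (closure {x, c}) := fun c hc =>
    isSolvable_of_le ((closure_le H).mpr (by rintro d (rfl | rfl) <;> assumption)) hH
  exact hx a b (key a ha) (key b hb)

theorem commute_of_commute (hx : HasCommSolubilizer x) {a b : G} (ha : x * a = a * x)
    (hb : x * b = b * x) : a * b = b * a :=
  hx a b (isSolvable_closure_pair_of_commute ha) (isSolvable_closure_pair_of_commute hb)

theorem of_injective (hx : HasCommSolubilizer x) {G' : Type*} [Group G'] {f : G' →* G}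
    (hf : Function.Injective f) {x' : G'} (hfx : f x' = x) : HasCommSolubilizer x' := by
  have key : ∀ c, Group.IsSolvable (closure {x', c}) → Group.IsSolvable (closure {x, f c}) := by
    intro c hc
    have := isSolvable_map f _ hc
    rwa [MonoidHom.map_closure, Set.image_pair, hfx] at this
  intro y z hy hz
  apply hf
  simpa using hx _ _ (key y hy) (key z hz)

theorem of_surjective (hx : HasCommSolubilizer x) {G' : Type*} [Group G'] {f : G →* G'}
    (hf : Function.Surjective f) (hker : Group.IsSolvable f.ker) : HasCommSolubilizer (f x) := by
  have key : ∀ c, Group.IsSolvable (closure {f x, f c}) → Group.IsSolvable (closure {x, c}) := by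
    intro c hc
    refine isSolvable_of_isSolvable_map f _ hker ?_
    rwa [MonoidHom.map_closure, Set.image_pair]
  intro y z hy hz
  obtain ⟨y, rfl⟩ := hf y
  obtain ⟨z, rfl⟩ := hf z
  rw [← map_mul, hx y z (key y hy) (key z hz), map_mul]

end HasCommSolubilizer

section Transfer

variable {G : Type*} [Group G] [Finite G]

/-- If a Sylow subgroup `P` of `A` satisfies `N_G(P) ≤ A`, then `P` is a Sylow subgroup of `G`. -/
theorem card_map_subtype_sylow_of_normalizer_le {p : ℕ} [hp : Fact p.Prime] {A : Subgroup G}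
    (P : Sylow p A) (hP : normalizer (P.map A.subtype : Set G) ≤ A) :
    Nat.card (P.map A.subtype) = p ^ (Nat.card G).factorization p := by
  have hcard : Nat.card (P.map A.subtype) = p ^ (Nat.card A).factorization p := by
    rw [← P.card_eq_multiplicity]
    exact Nat.card_congr (equivMapOfInjective _ _ A.subtype_injective).toEquiv.symm
  rw [hcard]
  congr 1
  refine le_antisymm ?_ ?_
  · exact (Nat.factorization_le_iff_dvd Nat.card_pos.ne' Nat.card_pos.ne').mpr
      (card_subgroup_dvd_card A) p
  · by_contra! hlt
    have hdvd : p ^ ((Nat.card A).factorization p + 1) ∣ Nat.card G :=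
      (Nat.pow_dvd_pow p hlt).trans (Nat.ordProj_dvd _ _)
    have hN := (Sylow.card_normalizer_modEq_card hcard).symm.dvd_iff (dvd_refl _) |>.mp hdvd
    exact Nat.pow_succ_factorization_not_dvd Nat.card_pos.ne' hp.out
      (hN.trans (card_dvd_of_le hP))

theorem commutator_inf_eq_bot_of_normalizer_le_centralizer {p : ℕ} [Fact p.Prime]
    (P : Sylow p G) (hP : normalizer (P : Set G) ≤ centralizer (P : Set G)) :
    commutator G ⊓ P = ⊥ := by
  have hle : commutator G ≤ (MonoidHom.transferSylow P hP).ker := by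
    rw [commutator_def, commutator_le]
    intro a _ b _
    rw [MonoidHom.mem_ker, map_commutatorElement, commutatorElement_eq_one_iff_mul_comm]
    exact Subtype.ext (hP (le_normalizer (SetLike.coe_mem _)) _ (SetLike.coe_mem _))
  exact le_bot_iff.mp ((inf_le_inf_right _ hle).trans
    (MonoidHom.ker_transferSylow_disjoint P hP P P.2).le_bot)

/-- If no nontrivial element of a normal subgroup `N` commutes with `x`, then every element of the
coset `N * x` is conjugate to `x` by an element of `N`. -/
theorem exists_conj_eq_mul_of_forall_commute_eq_one {N : Subgroup G} [hN : N.Normal] {x : G}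
    (hx : ∀ a ∈ N, x * a = a * x → a = 1) {k : G} (hk : k ∈ N) :
    ∃ n ∈ N, n⁻¹ * x * n = k * x := by
  let φ : N → N := fun n => ⟨(n : G)⁻¹ * (x * n * x⁻¹),
    N.mul_mem (N.inv_mem n.2) (hN.conj_mem n n.2 x)⟩
  have hφ : Function.Injective φ := by
    intro n m hnm
    have h1 : (n : G)⁻¹ * (x * n * x⁻¹) = (m : G)⁻¹ * (x * m * x⁻¹) := congrArg Subtype.val hnm
    have h2 : x * ((n : G) * (m : G)⁻¹) = n * (m : G)⁻¹ * x := by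
      have h3 : x * (n : G) = n * ((m : G)⁻¹ * x * m) := by
        calc x * (n : G) = n * ((n : G)⁻¹ * (x * n * x⁻¹)) * x := by group
          _ = n * ((m : G)⁻¹ * (x * m * x⁻¹)) * x := by rw [h1]
          _ = _ := by group
      rw [← mul_assoc, h3]; group
    exact Subtype.ext (mul_inv_eq_one.mp (hx _ (N.mul_mem n.2 (N.inv_mem m.2)) h2))
  obtain ⟨n, hn⟩ := (Finite.surjective_of_injective hφ) ⟨k, hk⟩
  have hn' : (n : G)⁻¹ * (x * n * x⁻¹) = k := congrArg Subtype.val hn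
  exact ⟨n, n.2, by rw [← hn']; group⟩

end Transfer

namespace HasCommSolubilizer

variable {G : Type*} [Group G] [Finite G] {x : G}

theorem eq_one_of_mem_commutator (hx : HasCommSolubilizer x)
    (hnormal : ∀ R : Subgroup G, R.Normal → Group.IsSolvable R → R = ⊥)
    (hproper : ∀ H : Subgroup G, H ≠ ⊤ → x ∈ H → ∀ a ∈ H, ∀ b ∈ H, a * b = b * a)
    {a : G} (ha : a ∈ commutator G) (hxa : x * a = a * x) : a = 1 := by
  set A : Subgroup G := centralizer {x} with hA
  have mem_A : ∀ {c : G}, c ∈ A ↔ x * c = c * x := by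
    intro c; rw [hA, mem_centralizer_singleton_iff]; exact eq_comm
  by_contra hne
  have hcard : Nat.card (commutator G ⊓ A : Subgroup G) ≠ 1 := by
    intro h1
    exact hne ((eq_bot_iff_forall _).mp (card_eq_one.mp h1) a ⟨ha, mem_A.mpr hxa⟩)
  obtain ⟨p, hp, hpdvd⟩ := Nat.exists_prime_and_dvd hcard
  have : Fact p.Prime := ⟨hp⟩
  obtain ⟨y, hy⟩ := exists_prime_orderOf_dvd_card' p hpdvd
  let y' : A := ⟨y, y.2.2⟩
  have hy' : orderOf y' = p := by
    rw [← hy, ← Subgroup.orderOf_coe, ← Subgroup.orderOf_coe]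
  obtain ⟨P, hP⟩ := (IsPGroup.of_card (p := p) (n := 1) (G := zpowers y')
    (by rw [Nat.card_zpowers, hy', pow_one])).exists_le_sylow
  set Q : Subgroup G := P.map A.subtype with hQ
  have hyQ : (y : G) ∈ Q := ⟨y', hP (mem_zpowers y'), rfl⟩
  have hy1 : (y : G) ≠ 1 := by
    intro h1
    rw [← Subgroup.orderOf_coe, h1, orderOf_one] at hy
    exact hp.one_lt.ne hy
  have hQA : Q ≤ A := map_subtype_le _
  have hcomm : ∀ c ∈ A, ∀ d ∈ A, c * d = d * c := fun c hc d hd =>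
    hx.commute_of_commute (mem_A.mp hc) (mem_A.mp hd)
  have hQsol : Group.IsSolvable Q := Group.isSolvable_of_comm fun c d =>
    Subtype.ext (hcomm c (hQA c.2) d (hQA d.2))
  have hxN : x ∈ normalizer (Q : Set G) := by
    have : A ≤ normalizer (Q : Set G) := by
      rw [le_normalizer_iff]
      intro c hc d hd
      rwa [hcomm c hc d (hQA hd), mul_inv_cancel_right]
    exact this (mem_A.mpr rfl)
  have hNtop : normalizer (Q : Set G) ≠ ⊤ := by
    intro h
    have := hnormal Q (normalizer_eq_top_iff.mp h) hQsol
    exact hy1 ((eq_bot_iff_forall _).mp this y hyQ)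
  have hNcomm := hproper _ hNtop hxN
  have hNA : normalizer (Q : Set G) ≤ A := fun c hc => mem_A.mpr (hNcomm x hxN c hc)
  let S : Sylow p G := Sylow.ofCard Q (card_map_subtype_sylow_of_normalizer_le P hNA)
  have hS : (S : Subgroup G) = Q := rfl
  have hbot := commutator_inf_eq_bot_of_normalizer_le_centralizer S
    (fun c hc d hd => hNcomm d (le_normalizer hd) c hc)
  exact hy1 ((eq_bot_iff_forall _).mp hbot y ⟨y.2.1, hyQ⟩)

theorem commutator_eq_bot (hx : HasCommSolubilizer x)
    (hnormal : ∀ R : Subgroup G, R.Normal → Group.IsSolvable R → R = ⊥)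
    (hproper : ∀ H : Subgroup G, H ≠ ⊤ → x ∈ H → ∀ a ∈ H, ∀ b ∈ H, a * b = b * a) :
    commutator G = ⊥ := by
  by_contra hne
  have hfree : ∀ a ∈ commutator G, x * a = a * x → a = 1 := fun a ha hxa =>
    hx.eq_one_of_mem_commutator hnormal hproper ha hxa
  obtain ⟨p, hp, hpdvd⟩ := Nat.exists_prime_and_dvd (mt card_eq_one.mp hne)
  have : Fact p.Prime := ⟨hp⟩
  obtain ⟨P⟩ : Nonempty (Sylow p (commutator G)) := inferInstance
  set Q : Subgroup G := P.map (commutator G).subtype with hQ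
  have hQsol : Group.IsSolvable Q := by
    have : Group.IsNilpotent P := P.2.isNilpotent
    exact isSolvable_map _ _ inferInstance
  have hQne : Q ≠ ⊥ := by
    rw [hQ, Ne, map_eq_bot_iff_of_injective _ (commutator G).subtype_injective]
    exact P.ne_bot_of_dvd_card hpdvd
  have hxtop : x ∈ normalizer (Q : Set G) ⊔ commutator G := by
    rw [hQ, Sylow.normalizer_sup_eq_top P]; trivial
  obtain ⟨m, hm, k, hk, hmk⟩ := mem_sup_of_normal_right.mp hxtop
  have hk' : x * k⁻¹ * x⁻¹ ∈ commutator G :=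
    Subgroup.Normal.conj_mem inferInstance _ (inv_mem hk) x
  obtain ⟨n, hn, hnx⟩ := exists_conj_eq_mul_of_forall_commute_eq_one hfree hk'
  have hmx : n * m * n⁻¹ = x := by
    have : m = n⁻¹ * x * n := by rw [hnx, ← hmk]; group
    rw [this]; group
  have hsol : Group.IsSolvable ((zpowers m ⊔ Q).map (MulAut.conj n).toMonoidHom) :=
    isSolvable_map _ _ (isSolvable_sup_of_le_normalizer (zpowers_le.mpr hm)
      (Group.isSolvable_of_comm fun a b => mul_comm' a b) hQsol)
  have hxmem : x ∈ (zpowers m ⊔ Q).map (MulAut.conj n).toMonoidHom :=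
    ⟨m, mem_sup_left (mem_zpowers m), by simpa using hmx⟩
  refine hQne ((eq_bot_iff_forall _).mpr fun q hq => ?_)
  have hqmem : n * q * n⁻¹ ∈ (zpowers m ⊔ Q).map (MulAut.conj n).toMonoidHom :=
    ⟨q, mem_sup_right hq, by simp⟩
  have hqN : n * q * n⁻¹ ∈ commutator G :=
    Subgroup.Normal.conj_mem inferInstance _ (map_subtype_le _ hq) n
  exact conj_eq_one_iff.mp (hfree _ hqN (hx.commute_of_mem hsol hxmem hxmem hqmem))

end HasCommSolubilizer

theorem isSolvable_of_hasCommSolubilizer (n : ℕ) : ∀ (G : Type*) [Group G] [Finite G],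
    Nat.card G = n → ∀ x : G, HasCommSolubilizer x → Group.IsSolvable G := by
  induction n using Nat.strong_induction_on with
  | _ n ih =>
    intro G _ _ hn x hx
    by_contra hG
    have hnormal : ∀ R : Subgroup G, R.Normal → Group.IsSolvable R → R = ⊥ := by
      intro R hR hsol
      by_contra hne
      refine hG ((Group.isSolvable_iff_subgroup_quotient R).mpr ⟨hsol, ?_⟩)
      refine ih (Nat.card (G ⧸ R)) ?_ (G ⧸ R) rfl (QuotientGroup.mk' R x)
        (hx.of_surjective (QuotientGroup.mk'_surjective R) (by rwa [QuotientGroup.ker_mk']))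
      rw [← hn, card_eq_card_quotient_mul_card_subgroup R]
      exact lt_mul_of_one_lt_right Nat.card_pos ((one_lt_card_iff_ne_bot R).mpr hne)
    have hproper : ∀ H : Subgroup G, H ≠ ⊤ → x ∈ H → ∀ a ∈ H, ∀ b ∈ H, a * b = b * a := by
      intro H hH hxH a ha b hb
      have hlt : Nat.card H < n :=
        hn ▸ lt_of_le_of_ne (card_le_card_group H) (mt H.card_eq_iff_eq_top.mp hH)
      exact hx.commute_of_mem (ih _ hlt H rfl ⟨x, hxH⟩
        (hx.of_injective H.subtype_injective rfl)) hxH ha hb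
    have hbot := hx.commutator_eq_bot hnormal hproper
    refine hG (Group.isSolvable_of_comm fun a b => ?_)
    rw [← commutatorElement_eq_one_iff_mul_comm]
    exact (eq_bot_iff_forall _).mp hbot _ (commutator_mem_commutator (mem_top a) (mem_top b))

theorem stmt_1 (G : Type*) [Group G] [Finite G]
    (h : ∃ x : G, ∀ y ∈ {g : G | IsSolvable (Subgroup.closure {x, g})},
        ∀ z ∈ {g : G | IsSolvable (Subgroup.closure {x, g})}, y * z = z * y) :
    ∀ a b : G, a * b = b * a := by
  obtain ⟨x, hx⟩ := h
  have hx' : HasCommSolubilizer x := fun y z hy hz => hx y hy z hz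
  have hG : Group.IsSolvable G := isSolvable_of_hasCommSolubilizer _ G rfl x hx'
  exact fun a b => hx'.commute_of_mem (H := ⊤) inferInstance (mem_top x) (mem_top a) (mem_top b)
end

section
/- Let G be a finite group and x ∈ G. Then the order of x divides the cardinality of Sol_G(x). -/
/-- A set stable under right translation by a subgroup has cardinality divisible by the order of
that subgroup. -/
theorem Subgroup.card_dvd_ncard_of_mul_mem {G : Type*} [Group G] (H : Subgroup G) (S : Set G)
    (hS : ∀ g ∈ S, ∀ h ∈ H, g * h ∈ S) : Nat.card H ∣ S.ncard := by
  have h_eq : (QuotientGroup.mk : G → G ⧸ H) ⁻¹' (QuotientGroup.mk '' S) = S := by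
    refine Set.Subset.antisymm ?_ (Set.subset_preimage_image _ _)
    rintro g ⟨s, hs, hsg⟩
    simpa using hS s hs _ (QuotientGroup.eq.mp hsg)
  rw [← h_eq, ← Nat.card_coe_set_eq,
    Nat.card_congr (QuotientGroup.preimageMkEquivSubgroupProdSet H _), Nat.card_prod]
  exact dvd_mul_right _ _

theorem Subgroup.closure_pair_mul_le {G : Type*} [Group G] (x g : G) {h : G}
    (hh : h ∈ Subgroup.zpowers x) :
    Subgroup.closure {x, g * h} ≤ Subgroup.closure {x, g} := by
  have hx : x ∈ Subgroup.closure {x, g} := Subgroup.subset_closure (by simp)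
  have hg : g ∈ Subgroup.closure {x, g} := Subgroup.subset_closure (by simp)
  rw [Subgroup.closure_le, Set.insert_subset_iff, Set.singleton_subset_iff]
  exact ⟨hx, mul_mem hg (Subgroup.zpowers_le.mpr hx hh)⟩

theorem stmt_2 (G : Type*) [Group G] [Finite G] (x : G) :
    orderOf x ∣ ({g : G | IsSolvable (Subgroup.closure {x, g})} : Set G).ncard := by
  rw [← Nat.card_zpowers]
  refine Subgroup.card_dvd_ncard_of_mul_mem _ _ fun g hg h hh => ?_
  have : Group.IsSolvable (Subgroup.closure {x, g}) := hg
  exact Group.isSolvable_of_isSolvable_injective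
    (Subgroup.inclusion_injective (Subgroup.closure_pair_mul_le x g hh))
end

section
/- Let G be a finite group, N a soluble normal subgroup of G, and x ∈ G. Then |N| divides |Sol_G(x)|. -/
/-- A subgroup is solvable iff its image modulo a solvable normal subgroup is. -/
theorem Subgroup.isSolvable_map_mk'_iff {G : Type*} [Group G] (N : Subgroup G) [N.Normal]
    [Group.IsSolvable N] (H : Subgroup G) :
    Group.IsSolvable (H.map (QuotientGroup.mk' N)) ↔ Group.IsSolvable H := by
  refine ⟨fun _ => ?_, fun _ => Group.isSolvable_of_surjective
    ((QuotientGroup.mk' N).subgroupMap_surjective H)⟩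
  have : Group.IsSolvable (N.subgroupOf H) :=
    Group.isSolvable_of_isSolvable_injective (f := H.subtype.subgroupComap N)
      fun a b hab => Subtype.ext (Subtype.ext (congrArg (fun n : N => (n : G)) hab))
  refine Group.isSolvable_of_ker_le_range (N.subgroupOf H).subtype
    ((QuotientGroup.mk' N).subgroupMap H) fun a ha => ?_
  rw [Subgroup.range_subtype, Subgroup.mem_subgroupOf, ← QuotientGroup.eq_one_iff]
  exact congrArg Subtype.val ha

theorem stmt_3 (G : Type*) [Group G] [Finite G] (N : Subgroup G) [N.Normal]
    (hN : IsSolvable N) (x : G) :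
    Nat.card N ∣ ({g : G | IsSolvable (Subgroup.closure {x, g})} : Set G).ncard := by
  have : Group.IsSolvable N := hN
  have h : {g : G | Group.IsSolvable (Subgroup.closure {x, g})} =
      QuotientGroup.mk (s := N) ⁻¹'
        {q : G ⧸ N | Group.IsSolvable (Subgroup.closure {(x : G ⧸ N), q})} := by
    ext g
    rw [Set.mem_ofPred_eq, ← Subgroup.isSolvable_map_mk'_iff N, MonoidHom.map_closure,
      Set.image_pair]
    rfl
  change _ ∣ {g : G | Group.IsSolvable (Subgroup.closure {x, g})}.ncard
  rw [h, ← Nat.card_coe_set_eq, Nat.card_congr (QuotientGroup.preimageMkEquivSubgroupProdSet N _),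
    Nat.card_prod]
  exact dvd_mul_right _ _
end

section
/- Let G be a finite group, N a soluble normal subgroup of G, and x ∈ G. Then Sol_{G/N}(xN) equals the image of Sol_G(x) under the canonical projection G → G/N, i.e., Sol_{G/N}(xN) = {yN : y ∈ Sol_G(x)}. -/
/-- A subgroup is solvable iff its image under a homomorphism with solvable kernel is. -/
theorem Subgroup.isSolvable_map_iff_of_isSolvable_ker {G G' : Type*} [Group G] [Group G']
    (f : G →* G') (hf : Group.IsSolvable f.ker) (H : Subgroup G) :
    Group.IsSolvable (H.map f) ↔ Group.IsSolvable H := by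
  constructor
  · intro h
    have hK : Group.IsSolvable (f.ker.subgroupOf H) :=
      Group.isSolvable_of_isSolvable_injective
        (f := (H.subtype.subgroupComap f.ker)) fun a b hab => by
          apply Subtype.ext
          apply Subtype.ext
          exact congrArg (fun z : f.ker => (z : G)) hab
    refine Group.isSolvable_of_ker_le_range (f.ker.subgroupOf H).subtype (f.subgroupMap H) ?_
    intro a ha
    rw [Subgroup.range_subtype, Subgroup.mem_subgroupOf, MonoidHom.mem_ker]
    exact congrArg Subtype.val (MonoidHom.mem_ker.mp ha)
  · intro h
    exact Group.isSolvable_of_surjective (f.subgroupMap_surjective H)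

theorem stmt_5 (G : Type*) [Group G] [Finite G] (N : Subgroup G) [N.Normal]
    (hN : IsSolvable N) (x : G) :
    {q : G ⧸ N | IsSolvable (Subgroup.closure {(x : G ⧸ N), q})} =
      (QuotientGroup.mk : G → G ⧸ N) '' {g : G | IsSolvable (Subgroup.closure {x, g})} := by
  have hker : Group.IsSolvable (QuotientGroup.mk' N).ker := by
    rw [QuotientGroup.ker_mk']
    exact hN
  have key (g : G) : Group.IsSolvable (Subgroup.closure {(x : G ⧸ N), (g : G ⧸ N)}) ↔
      Group.IsSolvable (Subgroup.closure {x, g}) := by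
    rw [← Subgroup.isSolvable_map_iff_of_isSolvable_ker (QuotientGroup.mk' N) hker,
      MonoidHom.map_closure, Set.image_pair]
    rfl
  ext q
  constructor
  · intro hq
    obtain ⟨g, rfl⟩ := QuotientGroup.mk_surjective q
    exact ⟨g, (key g).mp hq, rfl⟩
  · rintro ⟨g, hg, rfl⟩
    exact (key g).mpr hg
end

section
/- Let G be a finite group, N a soluble normal subgroup of G, x ∈ G, g ∈ Sol_G(x), and n ∈ N. Then gn ∈ Sol_G(x); that is, Sol_G(x) is a union of left cosets of N. -/
theorem stmt_7 (G : Type*) [Group G] [Finite G] (N : Subgroup G) [N.Normal]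
    (hN : IsSolvable N) (x g : G)
    (hg : g ∈ {g : G | IsSolvable (Subgroup.closure {x, g})})
    (n : G) (hn : n ∈ N) :
    g * n ∈ {g : G | IsSolvable (Subgroup.closure {x, g})} := by
  have hN : Group.IsSolvable N := hN
  have hg : Group.IsSolvable (Subgroup.closure {x, g}) := hg
  change Group.IsSolvable (Subgroup.closure {x, g * n})
  set π := QuotientGroup.mk' N
  have himage : (Subgroup.closure {x, g * n}).map π = (Subgroup.closure {x, g}).map π := by
    have hn' : π n = 1 := (QuotientGroup.eq_one_iff n).2 hn
    simp [MonoidHom.map_closure, Set.image_pair, hn']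
  have : Group.IsSolvable ((Subgroup.closure {x, g * n}).map π) := by
    rw [himage]
    exact Group.isSolvable_of_surjective (π.subgroupMap_surjective _)
  have : Group.IsSolvable (N.subgroupOf (Subgroup.closure {x, g * n})) :=
    Group.isSolvable_of_isSolvable_injective
      (f := (Subgroup.closure {x, g * n}).subtype.subgroupComap N)
      fun a b h ↦ Subtype.ext (Subtype.ext (congrArg (fun y : N ↦ (y : G)) h))
  refine Group.isSolvable_of_ker_le_range (N.subgroupOf (Subgroup.closure {x, g * n})).subtype
    (π.subgroupMap (Subgroup.closure {x, g * n})) fun y hy ↦ ?_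
  have hy' : π y = 1 := congrArg Subtype.val hy
  rw [Subgroup.range_subtype, Subgroup.mem_subgroupOf]
  exact (QuotientGroup.eq_one_iff _).1 hy'
end

section
/- Let G be a finite group that is not soluble and let x ∈ G. Then the cyclic subgroup ⟨x⟩ is properly contained in Sol_G(x); in particular, there exists a soluble subgroup H of G containing ⟨x⟩ properly. -/
section

variable {G : Type*} [Group G]

theorem Subgroup.coprime_card_index_of_conj_mem [Finite G] (C : Subgroup G)
    (hC : ∀ d ∈ C, d ≠ 1 → ∀ g : G, g⁻¹ * d * g ∈ C → g ∈ C) :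
    (Nat.card C).Coprime C.index := by
  refine Nat.Coprime.symm (Nat.coprime_of_dvd fun p hp hpi hpc => ?_)
  have : Fact p.Prime := ⟨hp⟩
  obtain ⟨⟨y, hyC⟩, hy⟩ := exists_prime_orderOf_dvd_card' p hpc
  rw [Subgroup.orderOf_mk] at hy
  have hy1 : y ≠ 1 := by
    rintro rfl
    rw [orderOf_one] at hy
    exact hp.one_lt.ne hy
  have hpg : IsPGroup p (Subgroup.zpowers y) :=
    IsPGroup.of_card (n := 1) (by rw [Nat.card_zpowers, hy, pow_one])
  have hfix : ∀ g : G, (g : G ⧸ C) ∈ MulAction.fixedPoints (Subgroup.zpowers y) (G ⧸ C) ↔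
      g⁻¹ * y * g ∈ C := by
    intro g
    constructor
    · intro h
      have h1 : ((y * g : G) : G ⧸ C) = g := h ⟨y, Subgroup.mem_zpowers y⟩
      have := QuotientGroup.eq.1 h1.symm
      rwa [← mul_assoc] at this
    · rintro h ⟨z, k, rfl⟩
      change ((y ^ k * g : G) : G ⧸ C) = g
      refine (QuotientGroup.eq.2 ?_).symm
      have h2 : g⁻¹ * (y ^ k * g) = (g⁻¹ * y * g) ^ k := by
        have := (conj_zpow (i := k) (a := g⁻¹) (b := y)).symm
        simpa [mul_assoc] using this
      rw [h2]
      exact C.zpow_mem h k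
  have h1 : ((1 : G) : G ⧸ C) ∈ MulAction.fixedPoints (Subgroup.zpowers y) (G ⧸ C) :=
    (hfix 1).2 (by simpa using hyC)
  obtain ⟨b, hb, hne⟩ := hpg.exists_fixed_point_of_prime_dvd_card_of_fixed_point (G ⧸ C) hpi h1
  induction b using QuotientGroup.induction_on with
  | H g =>
    refine hne (QuotientGroup.eq.2 ?_)
    simpa using hC y hyC hy1 g ((hfix g).1 hb)

theorem Subgroup.exists_normal_isCompl_of_conj_mem [Finite G] (C : Subgroup G) [IsMulCommutative C]
    (hC : ∀ d ∈ C, d ≠ 1 → ∀ g : G, g⁻¹ * d * g ∈ C → g ∈ C) :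
    ∃ N : Subgroup G, N.Normal ∧ C ⊓ N = ⊥ ∧ C ⊔ N = ⊤ := by
  have hcop := C.coprime_card_index_of_conj_mem hC
  let _ : CommGroup C := { (inferInstance : Group C) with mul_comm := mul_comm' }
  let τ : G →* C := MonoidHom.transfer (MonoidHom.id C)
  have hτ : ∀ c : C, τ c = powCoprime hcop c := by
    intro c
    refine (MonoidHom.transfer_eq_pow (MonoidHom.id C) (c : G) ?_).trans rfl
    intro k g hk
    by_cases h1 : (c : G) ^ k = 1
    · simp [h1]
    · have hg := hC _ (C.pow_mem c.2 k) h1 g hk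
      have := congrArg Subtype.val (mul_comm' (⟨g, hg⟩ : C) (c ^ k))
      have h2 : g * (c : G) ^ k = (c : G) ^ k * g := by simpa using this
      rw [mul_assoc, ← h2, inv_mul_cancel_left]
  refine ⟨τ.ker, inferInstance, ?_, ?_⟩
  · refine (Subgroup.eq_bot_iff_forall _).2 fun c hc => ?_
    obtain ⟨hcC, hck⟩ := hc
    have h1 := hτ ⟨c, hcC⟩
    rw [MonoidHom.mem_ker.1 hck, ← powCoprime_one (h := hcop)] at h1
    exact (congrArg Subtype.val ((powCoprime hcop).injective h1)).symm
  · refine eq_top_iff.2 fun g _ => ?_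
    obtain ⟨c, hc⟩ := (powCoprime hcop).surjective (τ g)
    rw [← hτ] at hc
    rw [← mul_inv_cancel_left (c : G) g]
    refine Subgroup.mul_mem_sup c.2 (MonoidHom.mem_ker.2 ?_)
    rw [map_mul, map_inv, hc, inv_mul_cancel]

theorem Subgroup.exists_isPGroup_mem_normalizer [Finite G] (N : Subgroup G) [N.Normal] (x : G)
    (hx : ∀ n ∈ N, n * x = x * n → n = 1) (p : ℕ) [Fact p.Prime] (hp : p ∣ Nat.card N) :
    ∃ Q : Subgroup G, Q ≤ N ∧ IsPGroup p Q ∧ Q ≠ ⊥ ∧ x ∈ Subgroup.normalizer (Q : Set G) := by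
  let f : N → N := fun n =>
    ⟨n * (x * (n : G)⁻¹ * x⁻¹),
      N.mul_mem n.2 (Subgroup.Normal.conj_mem inferInstance _ (N.inv_mem n.2) x)⟩
  have hf : Function.Injective f := by
    intro a b hab
    have h1 : (a : G) * (x * (a : G)⁻¹ * x⁻¹) = b * (x * (b : G)⁻¹ * x⁻¹) :=
      congrArg Subtype.val hab
    have h2 : (a : G) * x * (a : G)⁻¹ = b * x * (b : G)⁻¹ := by
      simpa only [← mul_assoc, mul_left_inj] using h1
    have h3 : (b : G)⁻¹ * a = 1 := by
      refine hx _ (N.mul_mem (N.inv_mem b.2) a.2) ?_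
      calc (b : G)⁻¹ * a * x = (b : G)⁻¹ * (a * x * (a : G)⁻¹) * a := by group
        _ = x * ((b : G)⁻¹ * a) := by rw [h2]; group
    exact Subtype.ext (inv_mul_eq_one.1 h3).symm
  have hfs : Function.Surjective f := Finite.surjective_of_injective hf
  let P : Sylow p N := default
  have htop := P.normalizer_sup_eq_top
  obtain ⟨m, hm, n, hn, hmn⟩ : ∃ m ∈ Subgroup.normalizer ((P : Subgroup N).map N.subtype : Set G),
      ∃ n ∈ N, m * n = x := Subgroup.mem_sup_of_normal_right.1 (htop ▸ Subgroup.mem_top x)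
  have hmx : m * x⁻¹ ∈ N := by
    have : m * x⁻¹ = x * n⁻¹ * x⁻¹ := by rw [← hmn]; group
    rw [this]
    exact Subgroup.Normal.conj_mem inferInstance _ (N.inv_mem hn) x
  obtain ⟨k, hk⟩ := hfs ⟨m * x⁻¹, hmx⟩
  have hk1 : (k : G) * (x * (k : G)⁻¹ * x⁻¹) = m * x⁻¹ := congrArg Subtype.val hk
  have hk2 : m = k * x * (k : G)⁻¹ := by
    refine mul_right_cancel (b := x⁻¹) ?_
    rw [← hk1]; group
  let φ : G ≃* G := MulAut.conj (k : G)⁻¹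
  refine ⟨((P : Subgroup N).map N.subtype).map φ.toMonoidHom, ?_, ?_, ?_, ?_⟩
  · rintro _ ⟨_, ⟨a, _, rfl⟩, rfl⟩
    exact Subgroup.Normal.conj_mem inferInstance _ a.2 _
  · exact (P.isPGroup'.map _).map _
  · intro h
    rw [Subgroup.map_eq_bot_iff_of_injective _ φ.injective,
      Subgroup.map_eq_bot_iff_of_injective _ N.subtype_injective] at h
    exact P.ne_bot_of_dvd_card hp h
  · rw [← Subgroup.map_equiv_normalizer_eq]
    refine ⟨m, hm, ?_⟩
    change (k : G)⁻¹ * m * (k : G)⁻¹⁻¹ = x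
    rw [hk2]; group

theorem Group.isSolvable_comap_mk (R : Subgroup G) [R.Normal] (H : Subgroup (G ⧸ R))
    [Group.IsSolvable R] [Group.IsSolvable H] :
    Group.IsSolvable (H.comap (QuotientGroup.mk' R)) := by
  let K := H.comap (QuotientGroup.mk' R)
  let f : R →* K := Subgroup.inclusion fun r hr => by
    change (QuotientGroup.mk' R) r ∈ H
    rw [show QuotientGroup.mk' R r = 1 from (QuotientGroup.eq_one_iff r).2 hr]
    exact H.one_mem
  let g : K →* H := (QuotientGroup.mk' R).subgroupComap H
  refine Group.isSolvable_of_ker_le_range f g fun k hk => ?_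
  have : QuotientGroup.mk' R (k : G) = 1 := congrArg Subtype.val (MonoidHom.mem_ker.1 hk)
  exact ⟨⟨k, (QuotientGroup.eq_one_iff _).1 this⟩, rfl⟩

theorem Group.not_isSolvable_quotient (R : Subgroup G) [R.Normal] [Group.IsSolvable R]
    (hG : ¬ Group.IsSolvable G) : ¬ Group.IsSolvable (G ⧸ R) := fun _ =>
  hG (Group.isSolvable_of_ker_le_range R.subtype (QuotientGroup.mk' R) (by simp))

end

theorem Group.exists_isSolvable_zpowers_lt (G : Type*) [Group G] [Finite G]
    (hG : ¬ Group.IsSolvable G) (x : G) :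
    ∃ H : Subgroup G, Group.IsSolvable H ∧ Subgroup.zpowers x < H := by
  induction hn : Nat.card G using Nat.strong_induction_on generalizing G with
  | _ n ih =>
  subst hn
  by_contra hcon
  have hmax : ∀ H : Subgroup G, Group.IsSolvable H → Subgroup.zpowers x ≤ H →
      H = Subgroup.zpowers x := fun H hH hle =>
    by_contra fun hne => hcon ⟨H, hH, lt_of_le_of_ne hle (Ne.symm hne)⟩
  have hab : ∀ y : G, Group.IsSolvable (Subgroup.zpowers y) := fun y => inferInstance
  have hnormal : ∀ R : Subgroup G, R.Normal → Group.IsSolvable R → R = ⊥ := by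
    intro R hR hRs
    by_contra hne
    have hcard : Nat.card (G ⧸ R) < Nat.card G := by
      rw [R.card_eq_card_quotient_mul_card_subgroup]
      exact lt_mul_of_one_lt_right Nat.card_pos ((Subgroup.one_lt_card_iff_ne_bot R).2 hne)
    obtain ⟨H, hH, hlt⟩ := ih _ hcard (G ⧸ R) (Group.not_isSolvable_quotient R hG)
      (QuotientGroup.mk' R x) rfl
    have hs := Group.isSolvable_comap_mk R H
    have hx : x ∈ H.comap (QuotientGroup.mk' R) := hlt.le (Subgroup.mem_zpowers _)
    have heq := hmax _ hs (Subgroup.zpowers_le.2 hx)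
    have := Subgroup.map_comap_eq_self_of_surjective (QuotientGroup.mk'_surjective R) H
    rw [heq, MonoidHom.map_zpowers] at this
    exact hlt.ne this
  have hover : ∀ M : Subgroup G, x ∈ M → M = ⊤ ∨ M = Subgroup.zpowers x := by
    intro M hxM
    by_cases hMs : Group.IsSolvable M
    · exact Or.inr (hmax M hMs (Subgroup.zpowers_le.2 hxM))
    refine Or.inl (by_contra fun hMt => ?_)
    have hcard : Nat.card M < Nat.card G :=
      lt_of_le_of_ne M.card_le_card_group fun h => hMt (Subgroup.eq_top_of_card_eq M h)
    obtain ⟨H, hH, hlt⟩ := ih _ hcard M hMs ⟨x, hxM⟩ rfl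
    have hlt' := (Subgroup.map_lt_map_iff_of_injective M.subtype_injective).2 hlt
    rw [MonoidHom.map_zpowers] at hlt'
    exact hcon ⟨H.map M.subtype,
      Group.isSolvable_of_surjective (f := M.subtype.subgroupMap H)
        (M.subtype.subgroupMap_surjective H), hlt'⟩
  have hx1 : x ≠ 1 := by
    rintro rfl
    refine hG ?_
    have : Subsingleton G := ⟨fun a b => by
      have h : ∀ y : G, y = 1 := fun y => by
        have := hmax (Subgroup.zpowers y) (hab y) (by simp)
        simpa using this
      rw [h a, h b]⟩
    infer_instance
  have hCbot : Subgroup.zpowers x ≠ ⊥ := by simpa using hx1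
  have hTI : ∀ d ∈ Subgroup.zpowers x, d ≠ 1 → ∀ g : G, g⁻¹ * d * g ∈ Subgroup.zpowers x →
      g ∈ Subgroup.zpowers x := by
    intro d hd hd1 g hg
    have hcomm : ∀ a ∈ Subgroup.zpowers x, ∀ b ∈ Subgroup.zpowers x, a * b = b * a := by
      rintro _ ⟨i, rfl⟩ _ ⟨j, rfl⟩
      exact (Commute.refl x).zpow_zpow i j
    have hxm := Subgroup.mem_zpowers x
    rcases hover (Subgroup.centralizer {d})
      (Subgroup.mem_centralizer_singleton_iff.2 (hcomm x hxm d hd)) with h | h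
    · have hdc : d ∈ Subgroup.center G := Subgroup.mem_center_iff.2 fun y =>
        Subgroup.mem_centralizer_singleton_iff.1 (h ▸ Subgroup.mem_top y)
      rw [hnormal (Subgroup.center G) inferInstance
        (Group.isSolvable_of_comm mul_comm')] at hdc
      exact absurd hdc hd1
    have hnorm : g ∈ Subgroup.normalizer (Subgroup.zpowers x : Set G) := by
      have hgx : g * x * g⁻¹ ∈ Subgroup.zpowers x := by
        rw [← h, Subgroup.mem_centralizer_singleton_iff]
        have := hcomm x hxm _ hg
        calc g * x * g⁻¹ * d = g * (x * (g⁻¹ * d * g)) * g⁻¹ := by group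
          _ = d * (g * x * g⁻¹) := by rw [this]; group
      have hle : (Subgroup.zpowers x).map (MulAut.conj g).toMonoidHom ≤ Subgroup.zpowers x := by
        rw [MonoidHom.map_zpowers, Subgroup.zpowers_le]
        exact hgx
      have heq : (Subgroup.zpowers x).map (MulAut.conj g).toMonoidHom = Subgroup.zpowers x :=
        Subgroup.eq_of_le_of_card_ge hle
          (Subgroup.card_map_of_injective (MulAut.conj g).injective).ge
      refine Subgroup.mem_normalizer_iff.2 fun y => ⟨fun hy => hle ⟨y, hy, rfl⟩, fun hy => ?_⟩
      rw [← heq] at hy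
      obtain ⟨z, hz, hzy⟩ := hy
      exact (MulAut.conj g).injective hzy ▸ hz
    rcases hover _ (Subgroup.le_normalizer hxm) with h' | h'
    · exact absurd (hnormal _ (Subgroup.normalizer_eq_top_iff.1 h') (hab x)) hCbot
    · exact h' ▸ hnorm
  obtain ⟨N, hN, hinf, hsup⟩ := (Subgroup.zpowers x).exists_normal_isCompl_of_conj_mem hTI
  have hNbot : N ≠ ⊥ := by
    rintro rfl
    rw [sup_bot_eq] at hsup
    have := hab x
    rw [hsup] at this
    exact hG (Group.isSolvable_of_surjective (f := (⊤ : Subgroup G).subtype)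
      fun y => ⟨⟨y, trivial⟩, rfl⟩)
  obtain ⟨p, hp, hpN⟩ := Nat.exists_prime_and_dvd ((Subgroup.one_lt_card_iff_ne_bot N).2 hNbot).ne'
  have : Fact p.Prime := ⟨hp⟩
  obtain ⟨Q, hQN, hQp, hQbot, hxQ⟩ := N.exists_isPGroup_mem_normalizer x (fun n hn hnx => by
    have h1 : n ∈ Subgroup.zpowers x := by
      refine hTI x (Subgroup.mem_zpowers x) hx1 n ?_
      rw [mul_assoc, ← hnx, inv_mul_cancel_left]
      exact Subgroup.mem_zpowers x
    have h2 : n ∈ Subgroup.zpowers x ⊓ N := ⟨h1, hn⟩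
    rwa [hinf] at h2) p hpN
  have := hQp.isNilpotent
  rcases hover _ hxQ with h | h
  · exact hQbot (hnormal Q (Subgroup.normalizer_eq_top_iff.1 h) inferInstance)
  · refine hQbot (le_bot_iff.1 ?_)
    rw [← hinf, ← h]
    exact le_inf Subgroup.le_normalizer hQN

theorem stmt_10 (G : Type*) [Group G] [Finite G] (hG : ¬ IsSolvable G) (x : G) :
    ((Subgroup.zpowers x : Subgroup G) : Set G) ⊂
        {g : G | IsSolvable (Subgroup.closure {x, g})} ∧
      ∃ H : Subgroup G, IsSolvable H ∧ Subgroup.zpowers x < H := by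
  obtain ⟨H, hH, hlt⟩ := Group.exists_isSolvable_zpowers_lt G hG x
  have hsol : ∀ K : Subgroup G, Group.IsSolvable K → x ∈ K → ∀ g ∈ K,
      Group.IsSolvable (Subgroup.closure {x, g}) := by
    intro K hK hx g hg
    have hle : Subgroup.closure {x, g} ≤ K := (Subgroup.closure_le K).2 (by
      rintro y (rfl | rfl)
      exacts [hx, hg])
    exact Group.isSolvable_of_isSolvable_injective (Subgroup.inclusion_injective hle)
  have hxm := Subgroup.mem_zpowers x
  obtain ⟨g, hgH, hgx⟩ := SetLike.exists_of_lt hlt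
  refine ⟨(Set.ssubset_iff_of_subset fun y hy => ?_).2 ⟨g, hsol H hH (hlt.le hxm) g hgH, hgx⟩,
    H, hH, hlt⟩
  exact hsol _ inferInstance hxm y hy
end
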